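/- arXiv:2309.04091 — 5 statements merged into one kernel-verified Lean document; each statement's English description precedes it below -/
import Mathlib

section
/- Let E be a real inner product space. For every r > 0 there exists a constant c > 0, depending only on r, such that for all x ∈ E with ‖x‖ = 1 and all v ∈ E with ⟪x, v⟫ = 0 and ‖v‖ ≤ r, one has arccos(⟪x, (x+v)/‖x+v‖⟫) ≥ c · ‖v‖. -/
open scoped InnerProductSpace

theorem sphere_retraction_dist_lower_bound
    {E : Type*} [NormedAddCommGroup E] [InnerProductSpace ℝ E] :
    ∀ r : ℝ, 0 < r → ∃ c : ℝ, 0 < c ∧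
      ∀ x v : E, ‖x‖ = 1 → ⟪x, v⟫_ℝ = 0 → ‖v‖ ≤ r →
        Real.arccos ⟪x, ‖x + v‖⁻¹ • (x + v)⟫_ℝ ≥ c * ‖v‖ := by
  intro r hr
  refine ⟨(1 + r)⁻¹, by positivity, ?_⟩
  intro x v hx hv hvr
  have hs2 : ‖x + v‖ ^ 2 = 1 + ‖v‖ ^ 2 := by
    rw [norm_add_sq_real, hx, hv]; ring
  have hle : ‖x + v‖ ≤ 1 + r := by
    have := norm_add_le x v
    linarith
  have hin : ⟪x, ‖x + v‖⁻¹ • (x + v)⟫_ℝ = ‖x + v‖⁻¹ := by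
    rw [real_inner_smul_right, inner_add_right, hv, real_inner_self_eq_norm_sq, hx]; ring
  rw [hin]
  have hn := norm_nonneg v
  have hs : 0 < ‖x + v‖ := by
    rcases (norm_nonneg (x + v)).eq_or_lt with h | h
    · rw [← h] at hs2; nlinarith
    · exact h
  generalize ‖x + v‖ = s at *
  have hc : (1 + r)⁻¹ ≤ s⁻¹ := inv_anti₀ hs hle
  have h1 : (1 + r)⁻¹ * ‖v‖ ≤ s⁻¹ * ‖v‖ := by gcongr
  have h2 : s⁻¹ * ‖v‖ ≤ Real.sqrt (1 - s⁻¹ ^ 2) := by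
    apply Real.le_sqrt_of_sq_le
    have : ‖v‖ ^ 2 = s ^ 2 - 1 := by linarith
    rw [mul_pow, this]
    apply le_of_eq
    field_simp
  have h3 := Real.sin_le (Real.arccos_nonneg s⁻¹)
  rw [Real.sin_arccos] at h3
  linarith
end

section
/- Let V be a real inner product space, let v, p, q ∈ V, let α, β be real numbers and δ > 0. If ‖v − p‖² + δ‖q‖² ≤ ‖v‖², then ‖β v − α (q + β p)‖² ≤ 2 [β²(1 + 2α² − 2α) + α²/δ] ‖v‖². -/
theorem rram_upper_bound_inequality
    {V : Type*} [NormedAddCommGroup V] [InnerProductSpace ℝ V]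
    (v p q : V) (α β δ : ℝ) (hδ : 0 < δ)
    (h : ‖v - p‖ ^ 2 + δ * ‖q‖ ^ 2 ≤ ‖v‖ ^ 2) :
    ‖β • v - α • (q + β • p)‖ ^ 2 ≤
      2 * (β ^ 2 * (1 + 2 * α ^ 2 - 2 * α) + α ^ 2 / δ) * ‖v‖ ^ 2 := by
  have e : β • v - α • (q + β • p)
      = (β * (1 - α)) • v + (β * α) • (v - p) + (-α) • q := by module
  have hn : ‖β • v - α • (q + β • p)‖
      ≤ |β * (1 - α)| * ‖v‖ + |β * α| * ‖v - p‖ + |α| * ‖q‖ := by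
    rw [e]
    refine norm_add₃_le.trans (le_of_eq ?_)
    simp only [norm_smul, Real.norm_eq_abs, abs_neg]
  have hs : 0 < √δ := Real.sqrt_pos.2 hδ
  have hs2 : √δ ^ 2 = δ := Real.sq_sqrt hδ.le
  have cs : ∀ a b c x y z : ℝ, (a * x + b * y + c * z) ^ 2
      ≤ (a ^ 2 + b ^ 2 + c ^ 2) * (x ^ 2 + y ^ 2 + z ^ 2) := by
    intro a b c x y z
    nlinarith [sq_nonneg (a * y - b * x), sq_nonneg (a * z - c * x), sq_nonneg (b * z - c * y)]
  have h1 := cs |β * (1 - α)| |β * α| (|α| / √δ) ‖v‖ ‖v - p‖ (√δ * ‖q‖)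
  have h2 : |α| / √δ * (√δ * ‖q‖) = |α| * ‖q‖ := by field_simp
  rw [h2, div_pow, mul_pow (√δ), hs2, sq_abs, sq_abs, sq_abs] at h1
  have h3 : 0 ≤ (β * (1 - α)) ^ 2 + (β * α) ^ 2 + α ^ 2 / δ := by positivity
  have h4 := mul_le_mul_of_nonneg_left
    (show ‖v‖ ^ 2 + ‖v - p‖ ^ 2 + δ * ‖q‖ ^ 2 ≤ 2 * ‖v‖ ^ 2 by linarith) h3
  calc _ ≤ _ := pow_le_pow_left₀ (norm_nonneg _) hn 2
    _ ≤ _ := h1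
    _ ≤ _ := h4
    _ = _ := by ring
end

section
/- Let V be a real inner product space, m a natural number, R, X : ℝ^m → V linear maps, δ > 0, α ≥ 0, β > 0, and v ∈ V. If Γ₀ ∈ ℝ^m is a minimizer of the regularized least-squares functional Γ ↦ ‖v − R Γ‖² + δ‖X Γ‖², then ‖β v − α (X Γ₀ + β R Γ₀)‖² ≤ 2 [β²(1 + 2α² − 2α) + α² δ^{-1}] ‖v‖². -/
theorem rram_operator_upper_bound
    {V : Type*} [NormedAddCommGroup V] [InnerProductSpace ℝ V]
    (m : ℕ) (R X : EuclideanSpace ℝ (Fin m) →ₗ[ℝ] V)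
    (δ α β : ℝ) (hδ : 0 < δ) (hα : 0 ≤ α) (hβ : 0 < β)
    (v : V) (Γ₀ : EuclideanSpace ℝ (Fin m))
    (hmin : ∀ Γ : EuclideanSpace ℝ (Fin m),
      ‖v - R Γ₀‖ ^ 2 + δ * ‖X Γ₀‖ ^ 2 ≤ ‖v - R Γ‖ ^ 2 + δ * ‖X Γ‖ ^ 2) :
    ‖β • v - α • (X Γ₀ + β • R Γ₀)‖ ^ 2 ≤
      2 * (β ^ 2 * (1 + 2 * α ^ 2 - 2 * α) + α ^ 2 * δ⁻¹) * ‖v‖ ^ 2 := by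
  have hp : inner ℝ v (R Γ₀) = ‖R Γ₀‖ ^ 2 + δ * ‖X Γ₀‖ ^ 2 := by
    have key : ∀ t : ℝ, 0 ≤ 2 * t * (‖R Γ₀‖ ^ 2 + δ * ‖X Γ₀‖ ^ 2 - inner ℝ v (R Γ₀))
        + t ^ 2 * (‖R Γ₀‖ ^ 2 + δ * ‖X Γ₀‖ ^ 2) := by
      intro t
      have h := hmin ((1 + t) • Γ₀)
      rw [map_smul, map_smul, norm_sub_sq_real, norm_sub_sq_real, norm_smul, norm_smul,
        inner_smul_right, mul_pow, mul_pow, Real.norm_eq_abs, sq_abs] at h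
      nlinarith [h]
    have hS : 0 ≤ ‖R Γ₀‖ ^ 2 + δ * ‖X Γ₀‖ ^ 2 := by positivity
    generalize ‖R Γ₀‖ ^ 2 + δ * ‖X Γ₀‖ ^ 2 = S at *
    generalize inner ℝ v (R Γ₀) = p at *
    have h := key (-(S - p) / (S + 1))
    have hD : 0 < S + 1 := by linarith
    have e : 2 * (-(S - p) / (S + 1)) * (S - p) + (-(S - p) / (S + 1)) ^ 2 * S
        = -((S - p) ^ 2 * (S + 2)) / (S + 1) ^ 2 := by
      field_simp
      ring
    rw [e, le_div_iff₀ (by positivity)] at h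
    have : (S - p) ^ 2 = 0 := by nlinarith [sq_nonneg (S - p), mul_nonneg (sq_nonneg (S - p)) hS]
    have := pow_eq_zero_iff (two_ne_zero) |>.mp this
    linarith
  have hcs : (inner ℝ v (R Γ₀)) ^ 2 ≤ ‖v‖ ^ 2 * ‖R Γ₀‖ ^ 2 := by
    rw [← mul_pow, ← sq_abs]
    exact pow_le_pow_left₀ (abs_nonneg _) (abs_real_inner_le_norm _ _) 2
  have hA : ‖v - α • R Γ₀‖ ^ 2 = ‖v‖ ^ 2 - 2 * α * inner ℝ v (R Γ₀) + α ^ 2 * ‖R Γ₀‖ ^ 2 := by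
    rw [norm_sub_sq_real, norm_smul, inner_smul_right, mul_pow, Real.norm_eq_abs, sq_abs]
    ring
  have hvec : β • v - α • (X Γ₀ + β • R Γ₀) = β • (v - α • R Γ₀) - α • X Γ₀ := by
    module
  have htri : ‖β • v - α • (X Γ₀ + β • R Γ₀)‖ ≤ β * ‖v - α • R Γ₀‖ + α * ‖X Γ₀‖ := by
    rw [hvec]
    refine (norm_sub_le _ _).trans ?_
    rw [norm_smul, norm_smul, Real.norm_of_nonneg hα, Real.norm_of_nonneg hβ.le]
  refine (pow_le_pow_left₀ (norm_nonneg _) htri 2).trans ?_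
  have hx0 : 0 ≤ ‖X Γ₀‖ := norm_nonneg _
  have hA0 : 0 ≤ ‖v - α • R Γ₀‖ := norm_nonneg _
  have hr0 : 0 ≤ ‖R Γ₀‖ := norm_nonneg _
  have hv0 : 0 ≤ ‖v‖ := norm_nonneg _
  clear htri hvec hmin
  generalize ‖v - α • R Γ₀‖ = A at *
  generalize ‖X Γ₀‖ = x at *
  generalize ‖R Γ₀‖ = r at *
  generalize inner ℝ v (R Γ₀) = p at *
  generalize ‖v‖ = n at *
  have hyx : x ^ 2 = δ⁻¹ * (δ * x ^ 2) := by field_simp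
  have hy0 : 0 ≤ δ * x ^ 2 := by positivity
  have hdi : 0 < δ⁻¹ := inv_pos.mpr hδ
  generalize δ * x ^ 2 = y at *
  generalize δ⁻¹ = d at *
  have hc : 0 < 1 + 2 * α ^ 2 - 2 * α := by nlinarith [sq_nonneg (2 * α - 1)]
  have hr2 : r ^ 2 = p - y := by linarith
  have hpp : 0 ≤ p := by nlinarith [sq_nonneg r]
  rw [hr2] at hA hcs
  rcases hv0.eq_or_lt with h0 | hn
  · subst h0
    have hp0 : p = 0 := by
      have : p ^ 2 = 0 := by nlinarith [sq_nonneg p]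
      exact pow_eq_zero_iff two_ne_zero |>.mp this
    have hyz : y = 0 := by nlinarith [sq_nonneg r]
    subst hp0 hyz
    have hx : x = 0 := by
      have : x ^ 2 = 0 := by linarith
      exact pow_eq_zero_iff two_ne_zero |>.mp this
    have hAz : A = 0 := by
      have : A ^ 2 = 0 := by rw [hA]; ring
      exact pow_eq_zero_iff two_ne_zero |>.mp this
    rw [hx, hAz]
    norm_num
  have hN : 0 < n ^ 2 := by positivity
  generalize n ^ 2 = N at *
  have hAb : A ^ 2 ≤ (1 + 2 * α ^ 2 - 2 * α) * (2 * N - y) := by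
    have h : 0 ≤ N * ((1 + 2 * α ^ 2 - 2 * α) * (2 * N - y) - A ^ 2) := by
      rw [hA]
      have h1 := sq_nonneg ((1 - 2 * α) * N - (1 - α) * p)
      have h2 : 0 ≤ p * N * (1 + 2 * α ^ 2 - 2 * α) := by positivity
      have h3 := mul_nonneg (sq_nonneg (1 - α)) (sub_nonneg.mpr hcs)
      linarith
    have := nonneg_of_mul_nonneg_right h hN
    linarith
  have hyN : 0 ≤ 2 * N - y := by
    by_contra hneg
    push Not at hneg
    nlinarith [sq_nonneg A, mul_pos hc (by linarith : 0 < y - 2 * N)]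
  -- Cauchy-type step
  have h2 : 2 * (β * A) * (α * x) ≤ β ^ 2 * (1 + 2 * α ^ 2 - 2 * α) * y
      + α ^ 2 * d * (2 * N - y) := by
    have hP : 0 ≤ β ^ 2 * (1 + 2 * α ^ 2 - 2 * α) := by positivity
    have hQ : 0 ≤ α ^ 2 * d := by positivity
    refine (sq_le_sq₀ (by positivity) (by positivity)).mp ?_
    have e : (2 * (β * A) * (α * x)) ^ 2 = 4 * β ^ 2 * α ^ 2 * (d * y) * A ^ 2 := by
      rw [← hyx]; ring
    rw [e]
    have h3 := mul_le_mul_of_nonneg_left hAb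
      (by positivity : 0 ≤ 4 * β ^ 2 * α ^ 2 * (d * y))
    have h4 := sq_nonneg (β ^ 2 * (1 + 2 * α ^ 2 - 2 * α) * y - α ^ 2 * d * (2 * N - y))
    linarith
  have ha : (β * A) ^ 2 ≤ β ^ 2 * ((1 + 2 * α ^ 2 - 2 * α) * (2 * N - y)) := by
    rw [mul_pow]
    exact mul_le_mul_of_nonneg_left hAb (by positivity)
  have hb : (α * x) ^ 2 = α ^ 2 * (d * y) := by rw [mul_pow, hyx]
  nlinarith [h2, ha, hb]
end

section
/- Let V be a real inner product space, m a natural number, R, X : ℝ^m → V linear maps, δ > 0, β a real number with 0 < β < 1, and α ≥ 0 a real number satisfying (2 + 1/(δ β²)) α² − 2α − 1 < 0. If v ∈ V and Γ₀ ∈ ℝ^m is a minimizer of the regularized least-squares functional Γ ↦ ‖v − R Γ‖² + δ‖X Γ‖², then ‖β v − α (X Γ₀ + β R Γ₀)‖ ≤ 2 β ‖v‖; in particular this norm is less than 4‖v‖ whenever v ≠ 0. -/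
theorem rram_update_norm_bound
    {V : Type*} [NormedAddCommGroup V] [InnerProductSpace ℝ V]
    (m : ℕ) (R X : EuclideanSpace ℝ (Fin m) →ₗ[ℝ] V)
    (δ β α : ℝ) (hδ : 0 < δ) (hβ0 : 0 < β) (hβ1 : β < 1) (hα : 0 ≤ α)
    (hparam : (2 + 1 / (δ * β ^ 2)) * α ^ 2 - 2 * α - 1 < 0)
    (v : V) (Γ₀ : EuclideanSpace ℝ (Fin m))
    (hmin : ∀ Γ : EuclideanSpace ℝ (Fin m),
      ‖v - R Γ₀‖ ^ 2 + δ * ‖X Γ₀‖ ^ 2 ≤ ‖v - R Γ‖ ^ 2 + δ * ‖X Γ‖ ^ 2) :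
    ‖β • v - α • (X Γ₀ + β • R Γ₀)‖ ≤ 2 * β * ‖v‖ ∧
    (v ≠ 0 → ‖β • v - α • (X Γ₀ + β • R Γ₀)‖ < 4 * ‖v‖) := by
  have hv1 : ∀ t : ℝ, 0 ≤ 2 * t * (δ * ‖X Γ₀‖ ^ 2 - (inner ℝ v (R Γ₀) - ‖R Γ₀‖ ^ 2))
      + t ^ 2 * (‖R Γ₀‖ ^ 2 + δ * ‖X Γ₀‖ ^ 2) := by
    intro t
    have h := hmin ((1 + t) • Γ₀)
    rw [map_smul, map_smul, norm_smul, mul_pow, Real.norm_eq_abs, sq_abs,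
      norm_sub_sq_real, norm_sub_sq_real, inner_smul_right, norm_smul, mul_pow,
      Real.norm_eq_abs, sq_abs] at h
    nlinarith [h]
  have e1 : ‖β • v - α • (X Γ₀ + β • R Γ₀)‖ ^ 2 ≤
      2 * β ^ 2 * (‖v‖ ^ 2 - 2 * α * inner ℝ v (R Γ₀) + α ^ 2 * ‖R Γ₀‖ ^ 2)
        + 2 * α ^ 2 * ‖X Γ₀‖ ^ 2 := by
    have h1 : β • v - α • (X Γ₀ + β • R Γ₀) = β • (v - α • R Γ₀) - α • X Γ₀ := by
      module
    have h2 := parallelogram_law_with_norm ℝ (β • (v - α • R Γ₀)) (α • X Γ₀)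
    have h3 : ‖β • (v - α • R Γ₀)‖ ^ 2 =
        β ^ 2 * (‖v‖ ^ 2 - 2 * α * inner ℝ v (R Γ₀) + α ^ 2 * ‖R Γ₀‖ ^ 2) := by
      rw [norm_smul, mul_pow, Real.norm_eq_abs, sq_abs, norm_sub_sq_real, inner_smul_right,
        norm_smul, mul_pow, Real.norm_eq_abs, sq_abs]
      ring
    have h4 : ‖α • X Γ₀‖ ^ 2 = α ^ 2 * ‖X Γ₀‖ ^ 2 := by
      rw [norm_smul, mul_pow, Real.norm_eq_abs, sq_abs]
    rw [h1]
    nlinarith [mul_self_nonneg ‖β • (v - α • R Γ₀) + α • X Γ₀‖]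
  have e2 : 0 ≤ ‖v‖ ^ 2 - 2 * inner ℝ v (R Γ₀) + ‖R Γ₀‖ ^ 2 := by
    rw [← norm_sub_sq_real]; positivity
  have hP : 0 ≤ ‖R Γ₀‖ ^ 2 := by positivity
  have hQ : 0 ≤ ‖X Γ₀‖ ^ 2 := by positivity
  have hmain : ‖β • v - α • (X Γ₀ + β • R Γ₀)‖ ≤ 2 * β * ‖v‖ := by
    refine (abs_le_of_sq_le_sq' ?_ (by positivity)).2
    generalize ‖β • v - α • (X Γ₀ + β • R Γ₀)‖ = N at *
    generalize ‖R Γ₀‖ ^ 2 = P at *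
    generalize ‖X Γ₀‖ ^ 2 = Q at *
    generalize (inner ℝ v (R Γ₀) : ℝ) = s at *
    clear hmin
    have hs : δ * Q - (s - P) = 0 := by
      generalize hB : δ * Q - (s - P) = B at *
      have hy : 0 ≤ δ * Q := by positivity
      generalize hA : P + δ * Q = A at *
      have hA0 : 0 ≤ A := by linarith
      have h := hv1 (-B / (A + 1))
      have h' : 2 * (-B / (A + 1)) * B + (-B / (A + 1)) ^ 2 * A
          = -(B ^ 2 * (A + 2)) / (A + 1) ^ 2 := by
        field_simp
        ring
      rw [h', le_div_iff₀ (by positivity)] at h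
      have : B ^ 2 = 0 := by nlinarith [sq_nonneg B, mul_nonneg (sq_nonneg B) hA0]
      exact pow_eq_zero_iff (two_ne_zero) |>.1 this
    have hs' : s = P + δ * Q := by linarith
    subst hs'
    have hc : 0 < 1 / (δ * β ^ 2) := by positivity
    have hcq : Q = β ^ 2 * (1 / (δ * β ^ 2)) * (δ * Q) := by field_simp
    generalize 1 / (δ * β ^ 2) = c at *
    have hy : 0 ≤ δ * Q := by positivity
    generalize δ * Q = y at *
    have k1 : α ^ 2 - 2 * α - 1 ≤ 0 := by nlinarith [mul_nonneg hc.le (sq_nonneg α), sq_nonneg α]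
    have k2 : c * α ^ 2 - 2 * α - 2 ≤ 0 := by nlinarith [sq_nonneg α]
    have k3 : -2 * α * (P + y) + α ^ 2 * P + α ^ 2 * c * y ≤ ‖v‖ ^ 2 := by
      nlinarith [mul_nonneg hP (neg_nonneg.2 k1), mul_nonneg hy (neg_nonneg.2 k2)]
    have k4 := mul_le_mul_of_nonneg_left k3 (by positivity : 0 ≤ 2 * β ^ 2)
    have k5 : 2 * α ^ 2 * Q = 2 * β ^ 2 * (α ^ 2 * c * y) := by rw [hcq]; ring
    nlinarith [e1, k4, k5]
  refine ⟨hmain, fun hv => ?_⟩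
  have : 0 < ‖v‖ := norm_pos_iff.2 hv
  nlinarith
end

section
/- Let n ≥ 2, let V₁, …, Vₙ be real normed vector spaces, and for each i ∈ {1, …, n−1} let Pᵢ : Vᵢ → V_{i+1} be a linear isometry and Tᵢ : Vᵢ → V_{i+1} a continuous linear map with operator norm at most M (where M ≥ 0). Suppose ρ ≥ 0 and d₁, …, d_{n−1} ≥ 0 are real numbers such that ‖Pᵢ w − Tᵢ w‖ ≤ ρ dᵢ ‖w‖ for every w ∈ Vᵢ and every i. Then for every v ∈ V₁, ‖(P_{n−1} ∘ ⋯ ∘ P₁)(v) − (T_{n−1} ∘ ⋯ ∘ T₁)(v)‖ ≤ ρ ‖v‖ ∑_{i=1}^{n−1} M^{i−1} dᵢ. -/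
/-- The composition `P (k-1) ∘ ⋯ ∘ P 0 : V 0 →ₗ[ℝ] V k` of a chain of linear maps. -/
def chainComp {V : ℕ → Type*} [∀ i, NormedAddCommGroup (V i)] [∀ i, NormedSpace ℝ (V i)]
    (P : ∀ i, V i →ₗ[ℝ] V (i + 1)) : ∀ k, V 0 →ₗ[ℝ] V k
  | 0 => LinearMap.id
  | (k + 1) => (P k).comp (chainComp P k)

theorem chain_transport_deviation
    (n : ℕ) (hn : 2 ≤ n)
    (V : ℕ → Type*) [∀ i, NormedAddCommGroup (V i)] [∀ i, NormedSpace ℝ (V i)]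
    (P T : ∀ i, V i →ₗ[ℝ] V (i + 1))
    (M ρ : ℝ) (hM : 0 ≤ M) (hρ : 0 ≤ ρ)
    (d : ℕ → ℝ) (hd : ∀ i < n - 1, 0 ≤ d i)
    (hPiso : ∀ i < n - 1, ∀ w : V i, ‖P i w‖ = ‖w‖)
    (hTnorm : ∀ i < n - 1, ∀ w : V i, ‖T i w‖ ≤ M * ‖w‖)
    (hdev : ∀ i < n - 1, ∀ w : V i, ‖P i w - T i w‖ ≤ ρ * d i * ‖w‖) :
    ∀ v : V 0,
      ‖chainComp P (n - 1) v - chainComp T (n - 1) v‖ ≤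
        ρ * ‖v‖ * ∑ i ∈ Finset.range (n - 1), M ^ i * d i := by
  have key : ∀ k, k ≤ n - 1 → ∀ v : V 0, ‖chainComp T k v‖ ≤ M ^ k * ‖v‖ ∧
      ‖chainComp P k v - chainComp T k v‖ ≤
        ρ * ‖v‖ * ∑ i ∈ Finset.range k, M ^ i * d i := by
    intro k
    induction k with
    | zero => intro _ v; simp [chainComp]
    | succ k ih =>
      intro hk v
      have hk' : k < n - 1 := hk
      obtain ⟨h1, h2⟩ := ih hk'.le v
      simp only [chainComp, LinearMap.comp_apply]
      constructor
      · calc _ ≤ M * ‖chainComp T k v‖ := hTnorm k hk' _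
          _ ≤ M * (M ^ k * ‖v‖) := by gcongr
          _ = _ := by ring
      · have e : P k (chainComp P k v) - T k (chainComp T k v) =
            P k (chainComp P k v - chainComp T k v) +
              (P k (chainComp T k v) - T k (chainComp T k v)) := by
          rw [map_sub]; abel
        have h3 := hdev k hk' (chainComp T k v)
        have h4 : ρ * d k * ‖chainComp T k v‖ ≤ ρ * d k * (M ^ k * ‖v‖) :=
          mul_le_mul_of_nonneg_left h1 (mul_nonneg hρ (hd k hk'))
        rw [e, Finset.sum_range_succ]
        refine (norm_add_le _ _).trans ?_
        rw [hPiso k hk']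
        linarith
  exact fun v => (key (n - 1) le_rfl v).2
end
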